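/- Let s ∈ (0,1), let a, b, c_ℓ, c_m ∈ ℝ² be such that T_ℓ = conv(a,b,c_ℓ) and T_m = conv(a,b,c_m) are nondegenerate closed triangles whose intersection is exactly the segment [a,b]. Set B_ℓ = [b−a | c_ℓ−b], B_m = [b−a | c_m−b] (columns), χ_ℓ(x̂) = B_ℓ x̂ + a, χ_m(x̂) = B_m x̂ + a. For x̂, ŷ ∈ T̂ define Φ₁ = φ̂₁(x̂)−φ̂₁(ŷ), Φ₂ = φ̂₂(x̂)−φ̂₂(ŷ), Φ₃ = φ̂₃(x̂), Φ₄ = −φ̂₃(ŷ). For η ∈ [0,1]³ define ψ⁽¹⁾(η) = (−η₁η₂, η₁(1−η₃), η₁η₃, −η₁(1−η₂)), ψ⁽²⁾(η) = (−η₁η₂η₃, −η₁(1−η₂), η₁, −η₁η₂(1−η₃)), ψ⁽³⁾(η) = (η₁η₂, −η₁(1−η₂η₃), η₁(1−η₂), −η₁η₂η₃), ψ⁽⁴⁾(η) = (η₁η₂η₃, η₁(1−η₂), η₁η₂(1−η₃), −η₁), ψ⁽⁵⁾(η) = (η₁η₂η₃, −η₁(1−η₂), η₁(1−η₂η₃),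 −η₁η₂); J⁽¹⁾(η) = η₁², J⁽ʰ⁾(η) = η₁²η₂ for h = 2,…,5; and d⁽¹⁾(η) = B_ℓ(1, η₁η₃) − B_m(1−η₁η₂, η₁(1−η₂)), d⁽²⁾(η) = B_ℓ(1, η₁) − B_m(1−η₁η₂η₃, η₁η₂(1−η₃)), d⁽³⁾(η) = B_ℓ(1−η₁η₂, η₁(1−η₂)) − B_m(1, η₁η₂η₃), d⁽⁴⁾(η) = B_ℓ(1−η₁η₂η₃, η₁η₂(1−η₃)) − B_m(1, η₁), d⁽⁵⁾(η) = B_ℓ(1−η₁η₂η₃, η₁(1−η₂η₃)) − B_m(1, η₁η₂). Then for all i, j ∈ {1,…,4}: ∬_{T̂×T̂} Φ_i(x̂,ŷ) Φ_j(x̂,ŷ) / |χ_ℓ(x̂)−χ_m(ŷ)|^{2+2s} dx̂ dŷ = (1/(4−2s)) Σ_{h=1}^{5} ∫_{[0,1]³} ψ⁽ʰ⁾_i(η) ψ⁽ʰ⁾_j(η) J⁽ʰ⁾(η) / |d⁽ʰ⁾(η)|^{2+2s} dη, and both sides are finite. (Equivalently, the element-pair integral I_{ℓ,m}^{i,j}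 for two triangles sharing exactly an edge equals 4|T_ℓ||T_m| times the left-hand side.) -/

import Mathlib

open MeasureTheory Real Filter Set

/-- The reference triangle `T̂ = {(x̂₁, x̂₂) : 0 ≤ x̂₂ ≤ x̂₁ ≤ 1} ⊂ ℝ²`. -/
def refTriangle : Set (EuclideanSpace ℝ (Fin 2)) :=
  {x | 0 ≤ x 1 ∧ x 1 ≤ x 0 ∧ x 0 ≤ 1}

/-- The nodal basis functions `φ̂₁(x̂)=1−x̂₁`, `φ̂₂(x̂)=x̂₁−x̂₂`, `φ̂₃(x̂)=x̂₂` on `T̂`. -/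
noncomputable def refBasis (i : Fin 3) (x : EuclideanSpace ℝ (Fin 2)) : ℝ :=
  ![1 - x 0, x 0 - x 1, x 1] i

/-- The point `(a, b) ∈ ℝ²` (with the Euclidean norm). -/
noncomputable def e2 (a b : ℝ) : EuclideanSpace ℝ (Fin 2) :=
  (WithLp.equiv 2 (Fin 2 → ℝ)).symm ![a, b]

/-- The `2×2` matrix with columns `u` and `v`. -/
noncomputable def colMatrix (u v : EuclideanSpace ℝ (Fin 2)) : Matrix (Fin 2) (Fin 2) ℝ :=
  Matrix.of fun r c => ![u r, v r] c

/-- The four local shape-function differences for a pair of edge-touching triangles: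
`Φ₁ = φ̂₁(x̂)−φ̂₁(ŷ)`, `Φ₂ = φ̂₂(x̂)−φ̂₂(ŷ)`, `Φ₃ = φ̂₃(x̂)`, `Φ₄ = −φ̂₃(ŷ)`. -/
noncomputable def phiEdge (i : Fin 4) (x y : EuclideanSpace ℝ (Fin 2)) : ℝ :=
  ![refBasis 0 x - refBasis 0 y, refBasis 1 x - refBasis 1 y,
    refBasis 2 x, -refBasis 2 y] i

/-- The five families `ψ⁽ʰ⁾` of shape functions on the unit cube (edge-touching case). -/
noncomputable def psiEdge (h : Fin 5) (i : Fin 4) (η : Fin 3 → ℝ) : ℝ :=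
  ![![-(η 0 * η 1), η 0 * (1 - η 2), η 0 * η 2, -(η 0 * (1 - η 1))],
    ![-(η 0 * η 1 * η 2), -(η 0 * (1 - η 1)), η 0, -(η 0 * η 1 * (1 - η 2))],
    ![η 0 * η 1, -(η 0 * (1 - η 1 * η 2)), η 0 * (1 - η 1), -(η 0 * η 1 * η 2)],
    ![η 0 * η 1 * η 2, η 0 * (1 - η 1), η 0 * η 1 * (1 - η 2), -(η 0)],
    ![η 0 * η 1 * η 2, -(η 0 * (1 - η 1)), η 0 * (1 - η 1 * η 2), -(η 0 * η 1)]] h i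

/-- The five Jacobian factors `J⁽¹⁾(η) = η₁²`, `J⁽ʰ⁾(η) = η₁² η₂` for `h = 2,…,5`. -/
noncomputable def jacEdge (h : Fin 5) (η : Fin 3 → ℝ) : ℝ :=
  ![(η 0) ^ 2, (η 0) ^ 2 * η 1, (η 0) ^ 2 * η 1, (η 0) ^ 2 * η 1, (η 0) ^ 2 * η 1] h

/-- The five transformed difference vectors `d⁽ʰ⁾(η)` (edge-touching case). -/
noncomputable def dEdge (Bl Bm : Matrix (Fin 2) (Fin 2) ℝ) (h : Fin 5) (η : Fin 3 → ℝ) :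
    EuclideanSpace ℝ (Fin 2) :=
  ![Matrix.toEuclideanLin Bl (e2 1 (η 0 * η 2)) -
      Matrix.toEuclideanLin Bm (e2 (1 - η 0 * η 1) (η 0 * (1 - η 1))),
    Matrix.toEuclideanLin Bl (e2 1 (η 0)) -
      Matrix.toEuclideanLin Bm (e2 (1 - η 0 * η 1 * η 2) (η 0 * η 1 * (1 - η 2))),
    Matrix.toEuclideanLin Bl (e2 (1 - η 0 * η 1) (η 0 * (1 - η 1))) -
      Matrix.toEuclideanLin Bm (e2 1 (η 0 * η 1 * η 2)),
    Matrix.toEuclideanLin Bl (e2 (1 - η 0 * η 1 * η 2) (η 0 * η 1 * (1 - η 2))) -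
      Matrix.toEuclideanLin Bm (e2 1 (η 0)),
    Matrix.toEuclideanLin Bl (e2 (1 - η 0 * η 1 * η 2) (η 0 * (1 - η 1 * η 2))) -
      Matrix.toEuclideanLin Bm (e2 1 (η 0 * η 1))] h


/-- The open unit cube in `ℝ⁴`. -/
def U4 : Set (Fin 4 → ℝ) := Set.univ.pi fun _ => Set.Ioo (0:ℝ) 1

lemma mem_U4 (t : Fin 4 → ℝ) : t ∈ U4 ↔ (0 < t 0 ∧ t 0 < 1) ∧ (0 < t 1 ∧ t 1 < 1) ∧
    (0 < t 2 ∧ t 2 < 1) ∧ (0 < t 3 ∧ t 3 < 1) := by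
  simp [U4, Set.mem_pi, Fin.forall_fin_succ]

lemma measurableSet_U4 : MeasurableSet U4 :=
  MeasurableSet.univ_pi fun _ => measurableSet_Ioo

lemma xi_integrable (s : ℝ) (hs1 : s < 1) :
    IntegrableOn (fun x : ℝ => x ^ (3 - 2 * s)) (Set.Ioo 0 1) := by
  have := (intervalIntegral.intervalIntegrable_rpow' (a := 0) (b := 1) (r := 3 - 2 * s)
    (by linarith))
  rw [intervalIntegrable_iff_integrableOn_Ioo_of_le zero_le_one] at this
  exact this

lemma xi_integral (s : ℝ) (hs1 : s < 1) :
    ∫ x in Set.Ioo (0:ℝ) 1, x ^ (3 - 2 * s) = 1 / (4 - 2 * s) := by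
  rw [← integral_Ioc_eq_integral_Ioo, ← intervalIntegral.integral_of_le zero_le_one,
    integral_rpow (Or.inl (by linarith))]
  have h : 3 - 2 * s + 1 = 4 - 2 * s := by ring
  rw [h, Real.one_rpow, Real.zero_rpow (by linarith)]
  simp

lemma cube_split (s : ℝ) (hs1 : s < 1) (R : (Fin 3 → ℝ) → ℝ)
    (hR : IntegrableOn R (Set.Icc 0 1)) :
    IntegrableOn (fun t : Fin 4 → ℝ => t 0 ^ (3 - 2 * s) * R (fun i => t i.succ)) U4 ∧
    ∫ t in U4, t 0 ^ (3 - 2 * s) * R (fun i => t i.succ) =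
      1 / (4 - 2 * s) * ∫ η in Set.Icc (0 : Fin 3 → ℝ) 1, R η := by
  have hae : (Set.univ.pi fun _ : Fin 3 => Set.Ioo (0:ℝ) 1) =ᵐ[volume]
      (Set.Icc (0 : Fin 3 → ℝ) 1) := by
    rw [volume_pi]
    exact Measure.univ_pi_Ioo_ae_eq_Icc (f := (0 : Fin 3 → ℝ)) (g := 1)
  set V : Set (Fin 3 → ℝ) := (Set.univ.pi fun _ : Fin 3 => Set.Ioo (0:ℝ) 1) with hV
  have hR' : IntegrableOn R V := hR.congr_set_ae hae
  set e := MeasurableEquiv.piFinSuccAbove (fun _ : Fin 4 => ℝ) 0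
  have he : MeasurePreserving e := volume_preserving_piFinSuccAbove (fun _ : Fin 4 => ℝ) 0
  have hpre : e ⁻¹' (Set.Ioo (0:ℝ) 1 ×ˢ V) = U4 := by
    ext t
    have h := mem_U4 t
    rw [h]
    simp only [Set.mem_preimage, Set.mem_prod, hV, e]
    simp [Set.mem_pi, Fin.forall_fin_succ]
    exact fun _ _ => Iff.rfl
  let G : ℝ × (Fin 3 → ℝ) → ℝ := fun z => z.1 ^ (3 - 2 * s) * R z.2
  have hG : IntegrableOn G (Set.Ioo (0:ℝ) 1 ×ˢ V) := by
    rw [IntegrableOn, Measure.volume_eq_prod, ← Measure.prod_restrict]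
    exact (xi_integrable s hs1).integrable.mul_prod hR'.integrable
  have hfun : (fun t : Fin 4 → ℝ => t 0 ^ (3 - 2 * s) * R (fun i => t i.succ)) = G ∘ e := by
    ext t
    simp [G, e]
    left
    rfl
  constructor
  · rw [hfun, ← hpre, he.integrableOn_comp_preimage e.measurableEmbedding]
    exact hG
  · have h1 := he.setIntegral_preimage_emb e.measurableEmbedding G (Set.Ioo (0:ℝ) 1 ×ˢ V)
    have h2 : ∀ t : Fin 4 → ℝ, t 0 ^ (3 - 2 * s) * R (fun i => t i.succ) = G (e t) :=
      fun t => congrFun hfun t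
    simp_rw [h2]
    rw [← hpre, h1, Measure.volume_eq_prod,
      setIntegral_prod_mul (fun x : ℝ => x ^ (3 - 2 * s)) R, xi_integral s hs1,
      setIntegral_congr_set hae]

lemma piece_integral (s : ℝ) (hs1 : s < 1) (F : (Fin 4 → ℝ) → (Fin 4 → ℝ))
    (F' : (Fin 4 → ℝ) → ((Fin 4 → ℝ) →L[ℝ] (Fin 4 → ℝ))) (P : Set (Fin 4 → ℝ))
    (hF : ∀ t ∈ U4, HasFDerivAt F (F' t) t) (inj : Set.InjOn F U4) (img : F '' U4 = P)
    (f : (Fin 4 → ℝ) → ℝ) (R : (Fin 3 → ℝ) → ℝ)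
    (hfR : ∀ t ∈ U4, |(F' t).det| * f (F t) = t 0 ^ (3 - 2 * s) * R (fun i => t i.succ))
    (hR : IntegrableOn R (Set.Icc 0 1)) :
    IntegrableOn f P ∧
      ∫ z in P, f z = 1 / (4 - 2 * s) * ∫ η in Set.Icc (0 : Fin 3 → ℝ) 1, R η := by
  have hw : ∀ t ∈ U4, HasFDerivWithinAt F (F' t) U4 t := fun t ht => (hF t ht).hasFDerivWithinAt
  obtain ⟨h1, h2⟩ := cube_split s hs1 R hR
  subst img
  constructor
  · rw [integrableOn_image_iff_integrableOn_abs_det_fderiv_smul volume measurableSet_U4 hw inj]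
    exact h1.congr_fun (fun t ht => (hfR t ht).symm) measurableSet_U4
  · rw [integral_image_eq_integral_abs_det_fderiv_smul volume measurableSet_U4 hw inj, ← h2]
    exact setIntegral_congr_fun measurableSet_U4 hfR

/-- The Duffy map used for the first region. -/
noncomputable def duffyA (t : Fin 4 → ℝ) : Fin 4 → ℝ :=
  ![t 0, t 0 * t 1, t 0 * t 1 * t 2, t 0 * t 1 * t 3]

/-- The Duffy map used for the other four regions. -/
noncomputable def duffyB (t : Fin 4 → ℝ) : Fin 4 → ℝ :=
  ![t 0, t 0 * t 1, t 0 * t 1 * t 2, t 0 * t 1 * t 2 * t 3]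

/-- Derivative matrix of `duffyA`. -/
noncomputable def duffyAder (t : Fin 4 → ℝ) : Matrix (Fin 4) (Fin 4) ℝ :=
  !![1, 0, 0, 0; t 1, t 0, 0, 0; t 1 * t 2, t 0 * t 2, t 0 * t 1, 0;
    t 1 * t 3, t 0 * t 3, 0, t 0 * t 1]

/-- Derivative matrix of `duffyB`. -/
noncomputable def duffyBder (t : Fin 4 → ℝ) : Matrix (Fin 4) (Fin 4) ℝ :=
  !![1, 0, 0, 0; t 1, t 0, 0, 0; t 1 * t 2, t 0 * t 2, t 0 * t 1, 0;
    t 1 * t 2 * t 3, t 0 * t 2 * t 3, t 0 * t 1 * t 3, t 0 * t 1 * t 2]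

/-- Matrix as a continuous linear map. -/
noncomputable def mclm (M : Matrix (Fin 4) (Fin 4) ℝ) : (Fin 4 → ℝ) →L[ℝ] (Fin 4 → ℝ) :=
  LinearMap.toContinuousLinearMap (Matrix.toLin' M)

lemma mclm_apply (M : Matrix (Fin 4) (Fin 4) ℝ) (v : Fin 4 → ℝ) : mclm M v = M.mulVec v := by
  simp [mclm]

lemma mclm_det (M : Matrix (Fin 4) (Fin 4) ℝ) : (mclm M).det = M.det := by
  simp [mclm, ContinuousLinearMap.det]

lemma duffyAder_det (t : Fin 4 → ℝ) : (duffyAder t).det = t 0 ^ 3 * t 1 ^ 2 := by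
  simp [duffyAder, Matrix.det_succ_row_zero, Fin.sum_univ_succ, Fin.succAbove]
  ring

lemma duffyBder_det (t : Fin 4 → ℝ) : (duffyBder t).det = t 0 ^ 3 * (t 1 ^ 2 * t 2) := by
  simp [duffyBder, Matrix.det_succ_row_zero, Fin.sum_univ_succ, Fin.succAbove]
  ring

lemma duffyA_hasFDerivAt (t : Fin 4 → ℝ) : HasFDerivAt duffyA (mclm (duffyAder t)) t := by
  have h : ∀ i : Fin 4, HasFDerivAt (fun t : Fin 4 → ℝ => t i)
    (ContinuousLinearMap.proj (R := ℝ) (φ := fun _ => ℝ) i) t := fun i => hasFDerivAt_apply i t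
  rw [hasFDerivAt_pi']
  intro i
  fin_cases i
  · convert! h 0 using 1
    ext v
    simp [mclm_apply, duffyAder, dotProduct, Fin.sum_univ_succ]
  · convert! (h 0).mul (h 1) using 1
    ext v
    simp [mclm_apply, duffyAder, dotProduct, Fin.sum_univ_succ]
    ring
  · convert! ((h 0).mul (h 1)).mul (h 2) using 1
    ext v
    simp [mclm_apply, duffyAder, dotProduct, Fin.sum_univ_succ]
    ring
  · convert! ((h 0).mul (h 1)).mul (h 3) using 1
    ext v
    simp [mclm_apply, duffyAder, dotProduct, Fin.sum_univ_succ]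
    ring

lemma duffyB_hasFDerivAt (t : Fin 4 → ℝ) : HasFDerivAt duffyB (mclm (duffyBder t)) t := by
  have h : ∀ i : Fin 4, HasFDerivAt (fun t : Fin 4 → ℝ => t i)
    (ContinuousLinearMap.proj (R := ℝ) (φ := fun _ => ℝ) i) t := fun i => hasFDerivAt_apply i t
  rw [hasFDerivAt_pi']
  intro i
  fin_cases i
  · convert! h 0 using 1
    ext v
    simp [mclm_apply, duffyBder, dotProduct, Fin.sum_univ_succ]
  · convert! (h 0).mul (h 1) using 1
    ext v
    simp [mclm_apply, duffyBder, dotProduct, Fin.sum_univ_succ]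
    ring
  · convert! ((h 0).mul (h 1)).mul (h 2) using 1
    ext v
    simp [mclm_apply, duffyBder, dotProduct, Fin.sum_univ_succ]
    ring
  · convert! (((h 0).mul (h 1)).mul (h 2)).mul (h 3) using 1
    ext v
    simp [mclm_apply, duffyBder, dotProduct, Fin.sum_univ_succ]
    ring

lemma duffyA_injOn : Set.InjOn duffyA U4 := by
  intro t ht u hu h
  rw [mem_U4] at ht hu
  have h0 : t 0 = u 0 := by simpa [duffyA] using congrFun h 0
  have h1 : t 0 * t 1 = u 0 * u 1 := by simpa [duffyA] using congrFun h 1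
  have h2 : t 0 * t 1 * t 2 = u 0 * u 1 * u 2 := by simpa [duffyA] using congrFun h 2
  have h3 : t 0 * t 1 * t 3 = u 0 * u 1 * u 3 := by simpa [duffyA] using congrFun h 3
  have p0 : u 0 ≠ 0 := hu.1.1.ne'
  have p1 : u 1 ≠ 0 := hu.2.1.1.ne'
  rw [h0] at h1 h2 h3
  have e1 := mul_left_cancel₀ p0 h1
  rw [e1] at h2 h3
  have e2 := mul_left_cancel₀ (mul_ne_zero p0 p1) h2
  have e3 := mul_left_cancel₀ (mul_ne_zero p0 p1) h3
  ext i
  fin_cases i <;> assumption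

lemma duffyB_injOn : Set.InjOn duffyB U4 := by
  intro t ht u hu h
  rw [mem_U4] at ht hu
  have h0 : t 0 = u 0 := by simpa [duffyB] using congrFun h 0
  have h1 : t 0 * t 1 = u 0 * u 1 := by simpa [duffyB] using congrFun h 1
  have h2 : t 0 * t 1 * t 2 = u 0 * u 1 * u 2 := by simpa [duffyB] using congrFun h 2
  have h3 : t 0 * t 1 * t 2 * t 3 = u 0 * u 1 * u 2 * u 3 := by
    simpa [duffyB] using congrFun h 3
  have p0 : u 0 ≠ 0 := hu.1.1.ne'
  have p1 : u 1 ≠ 0 := hu.2.1.1.ne'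
  have p2 : u 2 ≠ 0 := hu.2.2.1.1.ne'
  rw [h0] at h1 h2 h3
  have e1 := mul_left_cancel₀ p0 h1
  rw [e1] at h2 h3
  have e2 := mul_left_cancel₀ (mul_ne_zero p0 p1) h2
  rw [e2] at h3
  have e3 := mul_left_cancel₀ (mul_ne_zero (mul_ne_zero p0 p1) p2) h3
  ext i
  fin_cases i <;> assumption

lemma duffyA_image : duffyA '' U4 =
    {w | w 0 < 1 ∧ w 1 < w 0 ∧ w 2 < w 1 ∧ 0 < w 2 ∧ w 3 < w 1 ∧ 0 < w 3} := by
  ext w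
  simp only [Set.mem_image, Set.mem_ofPred_eq]
  constructor
  · rintro ⟨t, ht, rfl⟩
    rw [mem_U4] at ht
    obtain ⟨⟨a0, b0⟩, ⟨a1, b1⟩, ⟨a2, b2⟩, a3, b3⟩ := ht
    simp only [duffyA, Matrix.cons_val]
    have q1 : 0 < t 0 * t 1 := by positivity
    exact ⟨b0, by nlinarith, by nlinarith, by positivity, by nlinarith, by positivity⟩
  · rintro ⟨h0, h1, h2, h3, h4, h5⟩
    have p1 : 0 < w 1 := by linarith
    have p0 : 0 < w 0 := by linarith
    refine ⟨![w 0, w 1 / w 0, w 2 / w 1, w 3 / w 1], ?_, ?_⟩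
    · rw [mem_U4]
      simp only [Matrix.cons_val]
      refine ⟨⟨p0, h0⟩, ⟨by positivity, ?_⟩, ⟨by positivity, ?_⟩, ⟨by positivity, ?_⟩⟩ <;>
        rw [div_lt_one (by assumption)] <;> assumption
    · ext i
      fin_cases i <;> simp [duffyA] <;> field_simp

lemma duffyB_image : duffyB '' U4 =
    {w | w 0 < 1 ∧ w 1 < w 0 ∧ w 2 < w 1 ∧ w 3 < w 2 ∧ 0 < w 3} := by
  ext w
  simp only [Set.mem_image, Set.mem_ofPred_eq]
  constructor
  · rintro ⟨t, ht, rfl⟩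
    rw [mem_U4] at ht
    obtain ⟨⟨a0, b0⟩, ⟨a1, b1⟩, ⟨a2, b2⟩, a3, b3⟩ := ht
    simp only [duffyB, Matrix.cons_val]
    have q1 : 0 < t 0 * t 1 := by positivity
    have q2 : 0 < t 0 * t 1 * t 2 := by positivity
    exact ⟨b0, by nlinarith, by nlinarith, by nlinarith, by positivity⟩
  · rintro ⟨h0, h1, h2, h3, h4⟩
    have p2 : 0 < w 2 := by linarith
    have p1 : 0 < w 1 := by linarith
    have p0 : 0 < w 0 := by linarith
    refine ⟨![w 0, w 1 / w 0, w 2 / w 1, w 3 / w 2], ?_, ?_⟩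
    · rw [mem_U4]
      simp only [Matrix.cons_val]
      refine ⟨⟨p0, h0⟩, ⟨by positivity, ?_⟩, ⟨by positivity, ?_⟩, ⟨by positivity, ?_⟩⟩ <;>
        rw [div_lt_one (by assumption)] <;> assumption
    · ext i
      fin_cases i <;> simp [duffyB] <;> field_simp

/-- The linear (unimodular) maps from the Duffy simplices to the five regions. -/
noncomputable def linM (h : Fin 5) : Matrix (Fin 4) (Fin 4) ℝ :=
  ![!![1, 0, 0, 0; 0, 0, 0, 1; 1, 0, -1, 0; 0, 1, -1, 0],
    !![1, 0, 0, 0; 0, 1, 0, 0; 1, 0, 0, -1; 0, 0, 1, -1],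
    !![1, 0, -1, 0; 0, 1, -1, 0; 1, 0, 0, 0; 0, 0, 0, 1],
    !![1, 0, 0, -1; 0, 0, 1, -1; 1, 0, 0, 0; 0, 1, 0, 0],
    !![1, 0, 0, -1; 0, 1, 0, -1; 1, 0, 0, 0; 0, 0, 1, 0]] h

/-- Inverse matrices of `linM`. -/
noncomputable def linN (h : Fin 5) : Matrix (Fin 4) (Fin 4) ℝ :=
  ![!![1, 0, 0, 0; 1, 0, -1, 1; 1, 0, -1, 0; 0, 1, 0, 0],
    !![1, 0, 0, 0; 0, 1, 0, 0; 1, 0, -1, 1; 1, 0, -1, 0],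
    !![0, 0, 1, 0; -1, 1, 1, 0; -1, 0, 1, 0; 0, 0, 0, 1],
    !![0, 0, 1, 0; 0, 0, 0, 1; -1, 1, 1, 0; -1, 0, 1, 0],
    !![0, 0, 1, 0; -1, 1, 1, 0; 0, 0, 0, 1; -1, 0, 1, 0]] h

lemma linM_abs_det (h : Fin 5) : |(linM h).det| = 1 := by
  fin_cases h <;>
  simp [linM, Matrix.det_succ_row_zero, Fin.sum_univ_succ, Fin.succAbove]

lemma linM_linN (h : Fin 5) (z : Fin 4 → ℝ) : (linM h).mulVec ((linN h).mulVec z) = z := by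
  ext i
  fin_cases h <;> fin_cases i <;>
  simp [linM, linN, Matrix.mulVec, dotProduct, Fin.sum_univ_succ] <;> ring

lemma linN_linM (h : Fin 5) (z : Fin 4 → ℝ) : (linN h).mulVec ((linM h).mulVec z) = z := by
  ext i
  fin_cases h <;> fin_cases i <;>
  simp [linM, linN, Matrix.mulVec, dotProduct, Fin.sum_univ_succ] <;> ring

/-- The Duffy map for region `h`. -/
noncomputable def duffy (h : Fin 5) : (Fin 4 → ℝ) → (Fin 4 → ℝ) :=
  if h = 0 then duffyA else duffyB

/-- The derivative of the Duffy map for region `h`. -/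
noncomputable def duffyder (h : Fin 5) : (Fin 4 → ℝ) → Matrix (Fin 4) (Fin 4) ℝ :=
  if h = 0 then duffyAder else duffyBder

/-- The five regions. -/
def region (h : Fin 5) : Set (Fin 4 → ℝ) :=
  (linM h).mulVec '' (duffy h '' U4)

lemma mem_region (h : Fin 5) (z : Fin 4 → ℝ) :
    z ∈ region h ↔ (linN h).mulVec z ∈ duffy h '' U4 := by
  unfold region
  constructor
  · rintro ⟨w, hw, rfl⟩
    rwa [linN_linM]
  · intro hz
    exact ⟨_, hz, linM_linN h z⟩

lemma mem_region0 (z : Fin 4 → ℝ) : z ∈ region 0 ↔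
    z 0 < 1 ∧ z 3 < z 2 ∧ 0 < z 3 ∧ z 2 < z 0 ∧ z 1 < z 0 - z 2 + z 3 ∧ 0 < z 1 := by
  rw [mem_region]
  simp [duffy, duffyA_image, linN, dotProduct, Fin.sum_univ_succ]
  grind

lemma mem_region1 (z : Fin 4 → ℝ) : z ∈ region 1 ↔
    z 0 < 1 ∧ z 1 < z 0 ∧ z 0 - z 2 + z 3 < z 1 ∧ 0 < z 3 ∧ z 2 < z 0 := by
  rw [mem_region]
  simp [duffy, duffyB_image, linN, dotProduct, Fin.sum_univ_succ]
  grind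

lemma mem_region2 (z : Fin 4 → ℝ) : z ∈ region 2 ↔
    z 2 < 1 ∧ z 1 < z 0 ∧ 0 < z 1 ∧ z 3 < z 2 - z 0 ∧ 0 < z 3 := by
  rw [mem_region]
  simp [duffy, duffyB_image, linN, dotProduct, Fin.sum_univ_succ]
  grind

lemma mem_region3 (z : Fin 4 → ℝ) : z ∈ region 3 ↔
    z 2 < 1 ∧ z 3 < z 2 ∧ z 2 - z 0 + z 1 < z 3 ∧ 0 < z 1 ∧ z 0 < z 2 := by
  rw [mem_region]
  simp [duffy, duffyB_image, linN, dotProduct, Fin.sum_univ_succ]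
  grind

lemma mem_region4 (z : Fin 4 → ℝ) : z ∈ region 4 ↔
    z 2 < 1 ∧ z 1 < z 0 ∧ z 3 < z 2 - z 0 + z 1 ∧ z 2 - z 0 < z 3 ∧ z 0 < z 2 := by
  rw [mem_region]
  simp [duffy, duffyB_image, linN, dotProduct, Fin.sum_univ_succ]
  grind

/-- The difference coordinates `(x₁ - y₁, x₂, y₂)` in region `h`. -/
noncomputable def pqr (h : Fin 5) (η : Fin 3 → ℝ) : Fin 3 → ℝ :=
  ![![η 0 * η 1, η 0 * η 2, η 0 * (1 - η 1)],
    ![η 0 * η 1 * η 2, η 0, η 0 * η 1 * (1 - η 2)],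
    ![-(η 0 * η 1), η 0 * (1 - η 1), η 0 * η 1 * η 2],
    ![-(η 0 * η 1 * η 2), η 0 * η 1 * (1 - η 2), η 0],
    ![-(η 0 * η 1 * η 2), η 0 * (1 - η 1 * η 2), η 0 * η 1]] h

/-- The difference coordinates. -/
def dif (z : Fin 4 → ℝ) : Fin 3 → ℝ := ![z 0 - z 2, z 1, z 3]

lemma dif_duffy (h : Fin 5) (t : Fin 4 → ℝ) :
    dif ((linM h).mulVec (duffy h t)) = t 0 • pqr h (fun i => t i.succ) := by
  ext i
  fin_cases h <;> fin_cases i <;>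
    simp [dif, duffy, duffyA, duffyB, linM, pqr] <;> ring

lemma duffyder_det (h : Fin 5) (t : Fin 4 → ℝ) :
    (duffyder h t).det = t 0 ^ 3 * jacEdge h (fun i => t i.succ) := by
  fin_cases h <;> simp [duffyder, duffyAder_det, duffyBder_det, jacEdge]

lemma duffy_hasFDerivAt (h : Fin 5) (t : Fin 4 → ℝ) :
    HasFDerivAt (duffy h) (mclm (duffyder h t)) t := by
  unfold duffy duffyder
  split_ifs
  · exact duffyA_hasFDerivAt t
  · exact duffyB_hasFDerivAt t

lemma duffy_injOn (h : Fin 5) : Set.InjOn (duffy h) U4 := by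
  unfold duffy
  split_ifs
  · exact duffyA_injOn
  · exact duffyB_injOn

lemma jacEdge_nonneg (h : Fin 5) (η : Fin 3 → ℝ) (h1 : 0 ≤ η 1) : 0 ≤ jacEdge h η := by
  fin_cases h <;> simp [jacEdge] <;> positivity

lemma region_integral (s : ℝ) (hs1 : s < 1) (k : (Fin 3 → ℝ) → ℝ)
    (hk : ∀ ξ : ℝ, 0 < ξ → ∀ v, k (ξ • v) = ξ ^ (-(2 * s)) * k v) (h : Fin 5)
    (hR : IntegrableOn (fun η => k (pqr h η) * jacEdge h η) (Set.Icc 0 1)) :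
    IntegrableOn (fun z => k (dif z)) (region h) ∧
      ∫ z in region h, k (dif z) =
        1 / (4 - 2 * s) * ∫ η in Set.Icc (0 : Fin 3 → ℝ) 1, k (pqr h η) * jacEdge h η := by
  refine piece_integral s hs1 (fun t => mclm (linM h) (duffy h t))
    (fun t => (mclm (linM h)).comp (mclm (duffyder h t))) (region h) ?_ ?_ ?_
    (fun z => k (dif z)) _ ?_ hR
  · intro t _
    exact (mclm (linM h)).hasFDerivAt.comp t (duffy_hasFDerivAt h t)
  · intro t ht u hu htu
    apply duffy_injOn h ht hu
    simp only [mclm_apply] at htu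
    have := congrArg (linN h).mulVec htu
    rwa [linN_linM, linN_linM] at this
  · rw [region, Set.image_image]
    simp only [mclm_apply]
  · intro t ht
    rw [mem_U4] at ht
    have hdet : ((mclm (linM h)).comp (mclm (duffyder h t))).det =
        (linM h).det * (duffyder h t).det := by
      rw [← mclm_det, ← mclm_det]
      simp only [ContinuousLinearMap.det, ContinuousLinearMap.toLinearMap_comp, LinearMap.det_comp]
    have ht0 := ht.1.1
    rw [hdet, abs_mul, linM_abs_det, one_mul, duffyder_det,
      abs_of_nonneg (mul_nonneg (by positivity) (jacEdge_nonneg h _ ht.2.2.1.1.le))]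
    simp only [mclm_apply, dif_duffy, hk _ ht0]
    have : t 0 ^ (3 - 2 * s) = t 0 ^ 3 * t 0 ^ (-(2 * s)) := by
      rw [sub_eq_add_neg, Real.rpow_add ht0]
      norm_cast
    rw [this]
    ring

/-- The product of reference triangles in coordinates. -/
def TT : Set (Fin 4 → ℝ) :=
  {z | (0 ≤ z 1 ∧ z 1 ≤ z 0 ∧ z 0 ≤ 1) ∧ (0 ≤ z 3 ∧ z 3 ≤ z 2 ∧ z 2 ≤ 1)}

lemma region_measurable (h : Fin 5) : MeasurableSet (region h) := by
  have h0 : ∀ i : Fin 4, Measurable (fun z : Fin 4 → ℝ => z i) := fun i => measurable_pi_apply i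
  have lt : ∀ f g : (Fin 4 → ℝ) → ℝ, Measurable f → Measurable g →
    MeasurableSet {z | f z < g z} := fun f g hf hg => measurableSet_lt hf hg
  fin_cases h
  · have : region 0 = {z | z 0 < 1 ∧ z 3 < z 2 ∧ 0 < z 3 ∧ z 2 < z 0 ∧ z 1 < z 0 - z 2 + z 3 ∧
      0 < z 1} := by ext z; exact mem_region0 z
    simp only [Fin.zero_eta, this]
    measurability
  · have : region 1 = {z | z 0 < 1 ∧ z 1 < z 0 ∧ z 0 - z 2 + z 3 < z 1 ∧ 0 < z 3 ∧
      z 2 < z 0} := by ext z; exact mem_region1 z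
    simp only [Fin.mk_one, this]
    measurability
  · have : region 2 = {z | z 2 < 1 ∧ z 1 < z 0 ∧ 0 < z 1 ∧ z 3 < z 2 - z 0 ∧ 0 < z 3} := by
      ext z; exact mem_region2 z
    simp only [Fin.reduceFinMk, this]
    measurability
  · have : region 3 = {z | z 2 < 1 ∧ z 3 < z 2 ∧ z 2 - z 0 + z 1 < z 3 ∧ 0 < z 1 ∧
      z 0 < z 2} := by ext z; exact mem_region3 z
    simp only [Fin.reduceFinMk, this]
    measurability
  · have : region 4 = {z | z 2 < 1 ∧ z 1 < z 0 ∧ z 3 < z 2 - z 0 + z 1 ∧ z 2 - z 0 < z 3 ∧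
      z 0 < z 2} := by ext z; exact mem_region4 z
    simp only [Fin.reduceFinMk, this]
    measurability

lemma region_disjoint : Pairwise (Function.onFun Disjoint region) := by
  intro h g hne
  rw [Function.onFun, Set.disjoint_left]
  intro z hz hz'
  have e0 := mem_region0 z
  have e1 := mem_region1 z
  have e2 := mem_region2 z
  have e3 := mem_region3 z
  have e4 := mem_region4 z
  fin_cases h <;> fin_cases g <;>
    first
    | exact hne rfl
    | (simp only [Fin.zero_eta, Fin.mk_one, Fin.reduceFinMk, e0, e1, e2, e3, e4] at hz hz'
       grind)

lemma hyperplane_null (c : Fin 4 → ℝ) (d : ℝ) (hc : c ≠ 0) :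
    ∀ᵐ z : Fin 4 → ℝ, c 0 * z 0 + c 1 * z 1 + c 2 * z 2 + c 3 * z 3 ≠ d := by
  let L : (Fin 4 → ℝ) →ₗ[ℝ] ℝ := ∑ i, c i • LinearMap.proj i
  have hL : ∀ z, L z = c 0 * z 0 + c 1 * z 1 + c 2 * z 2 + c 3 * z 3 := by
    intro z; simp [L, Fin.sum_univ_succ]; ring
  let A : AffineSubspace ℝ (Fin 4 → ℝ) := (AffineSubspace.mk' d ⊥).comap L.toAffineMap
  have hA : ∀ z, z ∈ A ↔ L z = d := by
    intro z
    simp [A, AffineSubspace.mem_comap, AffineSubspace.mem_mk', sub_eq_zero]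
  have hne : A ≠ ⊤ := by
    intro htop
    have h1 : ∀ z, L z = d := fun z => (hA z).1 (htop ▸ AffineSubspace.mem_top ℝ _ z)
    have hd : d = 0 := by rw [← h1 0, map_zero]
    apply hc
    ext i
    have := h1 (Pi.single i 1)
    rw [hd, hL] at this
    fin_cases i <;> simpa [Pi.single_apply] using this
  have h0 := Measure.addHaar_affineSubspace volume A hne
  rw [ae_iff]
  convert h0 using 2
  ext z
  simp [hA, hL]

lemma TT_ae : TT =ᵐ[volume] ⋃ h, region h := by
  filter_upwards [hyperplane_null ![1, 0, -1, 0] 0 (fun h => by simpa using congrFun h 0),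
    hyperplane_null ![0, 1, 0, 0] 0 (fun h => by simpa using congrFun h 1),
    hyperplane_null ![0, 0, 0, 1] 0 (fun h => by simpa using congrFun h 3),
    hyperplane_null ![1, -1, 0, 0] 0 (fun h => by simpa using congrFun h 0),
    hyperplane_null ![0, 0, 1, -1] 0 (fun h => by simpa using congrFun h 2),
    hyperplane_null ![1, 0, 0, 0] 1 (fun h => by simpa using congrFun h 0),
    hyperplane_null ![0, 0, 1, 0] 1 (fun h => by simpa using congrFun h 2),
    hyperplane_null ![1, -1, -1, 1] 0 (fun h => by simpa using congrFun h 0),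
    hyperplane_null ![1, 0, -1, 1] 0 (fun h => by simpa using congrFun h 0)]
    with z h1 h2 h3 h4 h5 h6 h7 h8 h9
  simp only [Matrix.cons_val] at h1 h2 h3 h4 h5 h6 h7 h8 h9
  apply propext
  change z ∈ TT ↔ z ∈ ⋃ h, region h
  simp only [Set.mem_iUnion, Fin.exists_fin_succ, TT, Set.mem_ofPred_eq]
  have e0 := mem_region0 z
  have e1 := mem_region1 z
  have e2 := mem_region2 z
  have e3 := mem_region3 z
  have e4 := mem_region4 z
  have hr : (z ∈ region 0 ∨ z ∈ region 1 ∨ z ∈ region 2 ∨ z ∈ region 3 ∨ z ∈ region 4) ↔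
    ((0 ≤ z 1 ∧ z 1 ≤ z 0 ∧ z 0 ≤ 1) ∧ (0 ≤ z 3 ∧ z 3 ≤ z 2 ∧ z 2 ≤ 1)) := by
    rw [e0, e1, e2, e3, e4]
    clear e0 e1 e2 e3 e4
    constructor
    · rintro (h | h | h | h | h) <;> refine ⟨⟨?_, ?_, ?_⟩, ?_, ?_, ?_⟩ <;> linarith
    · rintro ⟨⟨a1, a2, a3⟩, b1, b2, b3⟩
      have a1' : 0 < z 1 := lt_of_le_of_ne a1 fun h => h2 (by linarith)
      have a2' : z 1 < z 0 := lt_of_le_of_ne a2 fun h => h4 (by linarith)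
      have a3' : z 0 < 1 := lt_of_le_of_ne a3 fun h => h6 (by linarith)
      have b1' : 0 < z 3 := lt_of_le_of_ne b1 fun h => h3 (by linarith)
      have b2' : z 3 < z 2 := lt_of_le_of_ne b2 fun h => h5 (by linarith)
      have b3' : z 2 < 1 := lt_of_le_of_ne b3 fun h => h7 (by linarith)
      rcases lt_trichotomy (z 0) (z 2) with h | h | h
      · rcases lt_trichotomy (z 3) (z 2 - z 0) with g | g | g
        · right; right; left; refine ⟨?_, ?_, ?_, ?_, ?_⟩ <;> linarith
        · exact absurd (by linarith) h9
        · rcases lt_trichotomy (z 3) (z 2 - z 0 + z 1) with f | f | f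
          · right; right; right; right; refine ⟨?_, ?_, ?_, ?_, ?_⟩ <;> linarith
          · exact absurd (by linarith) h8
          · right; right; right; left; refine ⟨?_, ?_, ?_, ?_, ?_⟩ <;> linarith
      · exact absurd (by linarith) h1
      · rcases lt_trichotomy (z 1) (z 0 - z 2 + z 3) with g | g | g
        · left; refine ⟨?_, ?_, ?_, ?_, ?_, ?_⟩ <;> linarith
        · exact absurd (by linarith) h8
        · right; left; refine ⟨?_, ?_, ?_, ?_, ?_⟩ <;> linarith
  rw [← hr]
  simp

lemma TT_integral (s : ℝ) (hs1 : s < 1) (k : (Fin 3 → ℝ) → ℝ)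
    (hk : ∀ ξ : ℝ, 0 < ξ → ∀ v, k (ξ • v) = ξ ^ (-(2 * s)) * k v)
    (hR : ∀ h, IntegrableOn (fun η => k (pqr h η) * jacEdge h η) (Set.Icc 0 1)) :
    IntegrableOn (fun z => k (dif z)) TT ∧
      ∫ z in TT, k (dif z) =
        1 / (4 - 2 * s) * ∑ h, ∫ η in Set.Icc (0 : Fin 3 → ℝ) 1, k (pqr h η) * jacEdge h η := by
  have hr := fun h => region_integral s hs1 k hk h (hR h)
  constructor
  · exact (integrableOn_finite_iUnion.2 fun h => (hr h).1).congr_set_ae TT_ae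
  · rw [setIntegral_congr_set TT_ae, integral_iUnion_fintype region_measurable region_disjoint
      (fun h => (hr h).1), Finset.mul_sum]
    exact Finset.sum_congr rfl fun h _ => (hr h).2

/-- The coordinate equivalence `ℝ² × ℝ² ≃ ℝ⁴`. -/
noncomputable def coordEquiv :
    (EuclideanSpace ℝ (Fin 2) × EuclideanSpace ℝ (Fin 2)) ≃ᵐ (Fin 4 → ℝ) :=
  ((MeasurableEquiv.prodCongr (MeasurableEquiv.toLp 2 (Fin 2 → ℝ)).symm
    (MeasurableEquiv.toLp 2 (Fin 2 → ℝ)).symm).trans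
    (MeasurableEquiv.sumPiEquivProdPi (fun _ : Fin 2 ⊕ Fin 2 => ℝ)).symm).trans
    (MeasurableEquiv.piCongrLeft (fun _ : Fin 4 => ℝ) (finSumFinEquiv : Fin 2 ⊕ Fin 2 ≃ Fin 4))

lemma coordEquiv_mp : MeasurePreserving coordEquiv := by
  have h1 : MeasurePreserving (MeasurableEquiv.prodCongr (MeasurableEquiv.toLp 2 (Fin 2 → ℝ)).symm
    (MeasurableEquiv.toLp 2 (Fin 2 → ℝ)).symm) := by
    have := EuclideanSpace.volume_preserving_symm_measurableEquiv_toLp (Fin 2)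
    exact this.prod this
  exact (h1.trans (volume_measurePreserving_sumPiEquivProdPi_symm
    (fun _ : Fin 2 ⊕ Fin 2 => ℝ))).trans
      (volume_measurePreserving_piCongrLeft (fun _ : Fin 4 => ℝ)
        (finSumFinEquiv : Fin 2 ⊕ Fin 2 ≃ Fin 4))

lemma coordEquiv_apply (q : EuclideanSpace ℝ (Fin 2) × EuclideanSpace ℝ (Fin 2)) :
    coordEquiv q = ![q.1 0, q.1 1, q.2 0, q.2 1] := by
  ext i
  fin_cases i <;> rfl

lemma coordEquiv_preimage : coordEquiv ⁻¹' TT = refTriangle ×ˢ refTriangle := by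
  ext q
  simp [TT, refTriangle, coordEquiv_apply]

/-- The difference vector as a function of the difference coordinates. -/
noncomputable def vec (u p q : EuclideanSpace ℝ (Fin 2)) (w : Fin 3 → ℝ) :
    EuclideanSpace ℝ (Fin 2) := w 0 • u + w 1 • p - w 2 • q

/-- The shape functions in the difference coordinates. -/
noncomputable def shape (i : Fin 4) (w : Fin 3 → ℝ) : ℝ :=
  ![-w 0, w 0 - w 1 + w 2, w 1, -w 2] i

/-- The two-dimensional cross product. -/
noncomputable def cross (u v : EuclideanSpace ℝ (Fin 2)) : ℝ := u 0 * v 1 - u 1 * v 0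

lemma toLin_col (u v x : EuclideanSpace ℝ (Fin 2)) :
    Matrix.toEuclideanLin (colMatrix u v) x = x 0 • u + x 1 • v := by
  ext i
  fin_cases i <;>
    simp [Matrix.toEuclideanLin, colMatrix, Matrix.mulVec, dotProduct, Fin.sum_univ_succ] <;> ring

lemma e2_zero (x y : ℝ) : e2 x y 0 = x := rfl
lemma e2_one (x y : ℝ) : e2 x y 1 = y := rfl

lemma phi_eq (i : Fin 4) (q : EuclideanSpace ℝ (Fin 2) × EuclideanSpace ℝ (Fin 2)) :
    phiEdge i q.1 q.2 = shape i (dif (coordEquiv q)) := by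
  fin_cases i <;> simp [phiEdge, shape, dif, coordEquiv_apply, refBasis] <;> ring

lemma psi_eq (h : Fin 5) (i : Fin 4) (η : Fin 3 → ℝ) :
    psiEdge h i η = shape i (pqr h η) := by
  fin_cases h <;> fin_cases i <;> simp [psiEdge, shape, pqr] <;> ring

lemma dEdge_eq (u p q : EuclideanSpace ℝ (Fin 2)) (h : Fin 5) (η : Fin 3 → ℝ) :
    dEdge (colMatrix u p) (colMatrix u q) h η = vec u p q (pqr h η) := by
  fin_cases h <;> simp only [dEdge, vec, pqr, toLin_col, e2_zero, e2_one] <;>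
    simp <;> module

lemma edge_diff_eq (a u p r : EuclideanSpace ℝ (Fin 2))
    (q : EuclideanSpace ℝ (Fin 2) × EuclideanSpace ℝ (Fin 2)) :
    (Matrix.toEuclideanLin (colMatrix u p) q.1 + a) -
      (Matrix.toEuclideanLin (colMatrix u r) q.2 + a) = vec u p r (dif (coordEquiv q)) := by
  simp only [toLin_col, vec, dif, coordEquiv_apply]
  simp
  module

lemma mem_hull3 (a b c : EuclideanSpace ℝ (Fin 2)) (x y z : ℝ) (hx : 0 ≤ x) (hy : 0 ≤ y)
    (hz : 0 ≤ z) (h : x + y + z = 1) :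
    x • a + y • b + z • c ∈ convexHull ℝ ({a, b, c} : Set (EuclideanSpace ℝ (Fin 2))) := by
  have hc := convex_convexHull ℝ ({a, b, c} : Set (EuclideanSpace ℝ (Fin 2)))
  have := hc.sum_mem (t := Finset.univ) (w := ![x, y, z]) (z := ![a, b, c]) ?_ ?_ ?_
  · simpa [Fin.sum_univ_succ, add_assoc] using this
  · intro i _
    fin_cases i <;> simpa
  · simp [Fin.sum_univ_succ]; linarith
  · intro i _
    apply subset_convexHull
    fin_cases i <;> simp

lemma cross_ne_zero (a b c : EuclideanSpace ℝ (Fin 2))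
    (h : ¬ Collinear ℝ ({a, b, c} : Set (EuclideanSpace ℝ (Fin 2)))) :
    cross (b - a) (c - b) ≠ 0 := by
  intro h0
  apply h
  by_cases hu : b - a = 0
  · have : b = a := sub_eq_zero.1 hu
    subst this
    simpa using collinear_pair ℝ b c
  rw [collinear_iff_of_mem (p₀ := a) (by simp)]
  refine ⟨b - a, ?_⟩
  have hc : ∃ r : ℝ, c = r • (b - a) + a := by
    simp only [cross, PiLp.sub_apply] at h0
    by_cases h1 : b 0 - a 0 = 0
    · have h2 : b 1 - a 1 ≠ 0 := by
        intro h2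
        apply hu
        ext i
        fin_cases i <;> simpa
      refine ⟨(c 1 - a 1) / (b 1 - a 1), ?_⟩
      have h3 : (b 1 - a 1) * (c 0 - b 0) = 0 := by rw [h1] at h0; linarith
      have h4 := (mul_eq_zero.1 h3).resolve_left h2
      ext i
      fin_cases i
      · simp [h1]; linarith
      · simp; field_simp; ring
    · refine ⟨(c 0 - a 0) / (b 0 - a 0), ?_⟩
      ext i
      fin_cases i
      · simp; field_simp; ring
      · simp; field_simp; linarith
  intro p hp
  simp only [Set.mem_insert_iff, Set.mem_singleton_iff] at hp
  rcases hp with rfl | rfl | rfl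
  · exact ⟨0, by simp⟩
  · exact ⟨1, by simp⟩
  · exact hc

lemma cross_opposite (a b cl cm : EuclideanSpace ℝ (Fin 2))
    (hl : cross (b - a) (cl - b) ≠ 0) (hm : cross (b - a) (cm - b) ≠ 0)
    (hint : convexHull ℝ ({a, b, cl} : Set (EuclideanSpace ℝ (Fin 2))) ∩
        convexHull ℝ ({a, b, cm} : Set (EuclideanSpace ℝ (Fin 2))) = segment ℝ a b) :
    cross (b - a) (cl - b) * cross (b - a) (cm - b) < 0 := by
  by_contra hcon
  have hpos : 0 < cross (b - a) (cl - b) * cross (b - a) (cm - b) :=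
    lt_of_le_of_ne (not_lt.1 hcon) (mul_ne_zero hl hm).symm
  set Dl := cross (b - a) (cl - b) with hDl
  set Dm := cross (b - a) (cm - b) with hDm
  obtain ⟨γ, hγ⟩ : ∃ γ, γ = Dm / Dl := ⟨_, rfl⟩
  obtain ⟨α, hα⟩ : ∃ α, α = cross (cm - b) (cl - b) / Dl := ⟨_, rfl⟩
  have hγ0 : 0 < γ := by
    have : γ = Dl * Dm / Dl ^ 2 := by rw [hγ]; field_simp
    rw [this]; positivity
  have hq : cm - b = α • (b - a) + γ • (cl - b) := by
    have g1 : α * Dl = cross (cm - b) (cl - b) := by rw [hα]; field_simp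
    have g2 : γ * Dl = Dm := by rw [hγ]; field_simp
    ext i
    apply mul_right_cancel₀ hl
    fin_cases i
    · simp only [Fin.zero_eta, PiLp.add_apply, PiLp.smul_apply, smul_eq_mul]
      rw [add_mul, mul_right_comm, mul_right_comm γ, g1, g2]
      simp [hDl, hDm, cross]; ring
    · simp only [Fin.mk_one, PiLp.add_apply, PiLp.smul_apply, smul_eq_mul]
      rw [add_mul, mul_right_comm, mul_right_comm γ, g1, g2]
      simp [hDl, hDm, cross]; ring
  have habs := neg_abs_le α
  have habs' := le_abs_self α
  have hab0 := abs_nonneg α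
  obtain ⟨ε, hε⟩ : ∃ ε : ℝ, ε = 1 / (2 + 2 * |α| + 2 * γ) := ⟨_, rfl⟩
  have hε0 : 0 < ε := by rw [hε]; positivity
  have hε1 : ε * (2 + 2 * |α| + 2 * γ) = 1 := by rw [hε]; field_simp
  have m1 : 0 ≤ ε * |α| := by positivity
  have m2 : 0 < ε * γ := by positivity
  have m3 : ε * α ≤ ε * |α| := by gcongr
  have m4 : ε * (-|α|) ≤ ε * α := by gcongr
  have hP1 := mem_hull3 a b cm ((1 - ε) / 2) ((1 - ε) / 2) ε (by nlinarith) (by nlinarith)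
    hε0.le (by ring)
  have hP2 := mem_hull3 a b cl ((1 - ε) / 2 - ε * α) (1 - ((1 - ε) / 2 - ε * α) - ε * γ) (ε * γ)
    (by nlinarith) (by nlinarith) m2.le (by ring)
  have heq : ((1 - ε) / 2 - ε * α) • a + (1 - ((1 - ε) / 2 - ε * α) - ε * γ) • b + (ε * γ) • cl =
      ((1 - ε) / 2) • a + ((1 - ε) / 2) • b + ε • cm := by
    have : cm = b + (α • (b - a) + γ • (cl - b)) := by rw [← hq]; abel
    rw [this]
    module
  rw [heq] at hP2
  have hP := Set.mem_inter hP2 hP1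
  rw [hint] at hP
  obtain ⟨x, y, hx, hy, hxy, hxyP⟩ := hP
  have hx' : x = 1 - y := by linarith
  subst hx'
  have c0 := congrArg (fun v : EuclideanSpace ℝ (Fin 2) => v 0) hxyP
  have c1 := congrArg (fun v : EuclideanSpace ℝ (Fin 2) => v 1) hxyP
  simp at c0 c1
  have : ε * Dm = 0 := by
    simp only [hDm, cross, PiLp.sub_apply]
    linear_combination (b 1 - a 1) * c0 - (b 0 - a 0) * c1
  rcases mul_eq_zero.1 this with h | h
  · exact hε0.ne' h
  · exact hm h

lemma vec_bound (u p q : EuclideanSpace ℝ (Fin 2)) (h : cross u p * cross u q < 0) :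
    ∃ C : ℝ, 0 < C ∧ ∀ w : Fin 3 → ℝ, 0 ≤ w 1 → 0 ≤ w 2 →
      |w 0| + w 1 + w 2 ≤ C * ‖vec u p q w‖ := by
  have hp : 0 < |cross u p| := abs_pos.2 fun h0 => by simp [h0] at h
  have hq : 0 < |cross u q| := abs_pos.2 fun h0 => by simp [h0] at h
  have hu : 0 < ‖u‖ := norm_pos_iff.2 fun h0 => by simp [h0, cross] at h
  set A := |u 0| + |u 1| with hA
  have hA0 : 0 ≤ A := by positivity
  have hcr : ∀ v, |cross u v| ≤ A * ‖v‖ := by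
    intro v
    have h0 : |v 0| ≤ ‖v‖ := by simpa using PiLp.norm_apply_le v 0
    have h1 : |v 1| ≤ ‖v‖ := by simpa using PiLp.norm_apply_le v 1
    calc |cross u v| ≤ |u 0 * v 1| + |u 1 * v 0| := abs_sub _ _
      _ = |u 0| * |v 1| + |u 1| * |v 0| := by rw [abs_mul, abs_mul]
      _ ≤ |u 0| * ‖v‖ + |u 1| * ‖v‖ := by gcongr
      _ = A * ‖v‖ := by rw [hA]; ring
  set C1 := A / |cross u p| with hC1
  set C2 := A / |cross u q| with hC2
  refine ⟨(1 + C1 * ‖p‖ + C2 * ‖q‖) / ‖u‖ + C1 + C2, by positivity, ?_⟩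
  intro w h1 h2
  set v := vec u p q w with hv
  have hsum : |cross u v| = w 1 * |cross u p| + w 2 * |cross u q| := by
    have e : cross u v = w 1 * cross u p - w 2 * cross u q := by
      simp [hv, vec, cross]; ring
    rw [e]
    rcases mul_neg_iff.1 h with ⟨g1, g2⟩ | ⟨g1, g2⟩
    · rw [abs_of_pos g1, abs_of_neg g2, abs_of_nonneg (by nlinarith)]; ring
    · rw [abs_of_neg g1, abs_of_pos g2, abs_of_nonpos (by nlinarith)]; ring
  have hv' := hcr v
  have n1 : 0 ≤ w 1 * |cross u p| := by positivity
  have n2 : 0 ≤ w 2 * |cross u q| := by positivity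
  have b1 : w 1 ≤ C1 * ‖v‖ := by
    rw [hC1, div_mul_eq_mul_div, le_div_iff₀ hp]; linarith
  have b2 : w 2 ≤ C2 * ‖v‖ := by
    rw [hC2, div_mul_eq_mul_div, le_div_iff₀ hq]; linarith
  have b0 : |w 0| ≤ (1 + C1 * ‖p‖ + C2 * ‖q‖) / ‖u‖ * ‖v‖ := by
    rw [div_mul_eq_mul_div, le_div_iff₀ hu]
    have e : w 0 • u = v - w 1 • p + w 2 • q := by rw [hv, vec]; abel
    calc |w 0| * ‖u‖ = ‖w 0 • u‖ := by rw [norm_smul, Real.norm_eq_abs]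
      _ = ‖v - w 1 • p + w 2 • q‖ := by rw [e]
      _ ≤ ‖v‖ + ‖w 1 • p‖ + ‖w 2 • q‖ :=
        (norm_add_le _ _).trans (by gcongr; exact norm_sub_le _ _)
      _ = ‖v‖ + w 1 * ‖p‖ + w 2 * ‖q‖ := by
        rw [norm_smul, norm_smul, Real.norm_eq_abs, Real.norm_eq_abs, abs_of_nonneg h1,
          abs_of_nonneg h2]
      _ ≤ ‖v‖ + (C1 * ‖v‖) * ‖p‖ + (C2 * ‖v‖) * ‖q‖ := by gcongr
      _ = (1 + C1 * ‖p‖ + C2 * ‖q‖) * ‖v‖ := by ring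
  linarith

/-- The kernel in difference coordinates. -/
noncomputable def edgeKer (s : ℝ) (u p q : EuclideanSpace ℝ (Fin 2)) (i j : Fin 4)
    (w : Fin 3 → ℝ) : ℝ :=
  shape i w * shape j w / ‖vec u p q w‖ ^ ((2 : ℝ) + 2 * s)

lemma ker_hom (s : ℝ) (u p q : EuclideanSpace ℝ (Fin 2)) (i j : Fin 4) (ξ : ℝ) (hξ : 0 < ξ)
    (w : Fin 3 → ℝ) : edgeKer s u p q i j (ξ • w) = ξ ^ (-(2 * s)) * edgeKer s u p q i j w := by
  have h1 : ∀ i, shape i (ξ • w) = ξ * shape i w := by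
    intro i
    fin_cases i <;> simp [shape] <;> ring
  have h2 : vec u p q (ξ • w) = ξ • vec u p q w := by
    simp only [vec, Pi.smul_apply, smul_eq_mul]; module
  have h3 : ξ ^ ((2 : ℝ) + 2 * s) = ξ ^ 2 * ξ ^ (2 * s) := by
    rw [Real.rpow_add hξ]; norm_cast
  have h4 : 0 < ξ ^ (2 * s) := Real.rpow_pos_of_pos hξ _
  rw [edgeKer, edgeKer, h1, h1, h2, norm_smul, Real.norm_eq_abs, abs_of_pos hξ,
    Real.mul_rpow hξ.le (norm_nonneg _), h3, Real.rpow_neg hξ.le]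
  rw [show ξ * shape i w * (ξ * shape j w) = ξ ^ 2 * (shape i w * shape j w) by ring,
    mul_assoc, mul_div_mul_left _ _ (by positivity : ξ ^ 2 ≠ 0), div_mul_eq_div_div_swap]
  field_simp

lemma pqr_measurable (h : Fin 5) : Measurable (pqr h) := by
  rw [measurable_pi_iff]
  intro i
  fin_cases h <;> fin_cases i <;> simp [pqr] <;> fun_prop

lemma jac_measurable (h : Fin 5) : Measurable (jacEdge h) := by
  unfold jacEdge
  fin_cases h <;> simp <;> fun_prop

lemma shape_measurable (i : Fin 4) : Measurable (shape i) := by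
  unfold shape
  fin_cases i <;> simp <;> fun_prop

lemma ker_measurable (s : ℝ) (u p q : EuclideanSpace ℝ (Fin 2)) (i j : Fin 4) :
    Measurable (edgeKer s u p q i j) := by
  have hv : Measurable fun w => ‖vec u p q w‖ := by
    apply Continuous.measurable
    unfold vec
    fun_prop
  exact ((shape_measurable i).mul (shape_measurable j)).div (hv.pow_const _)

lemma pqr_facts (h : Fin 5) (η : Fin 3 → ℝ) (hη : η ∈ Set.Icc (0 : Fin 3 → ℝ) 1) :
    0 ≤ pqr h η 1 ∧ 0 ≤ pqr h η 2 ∧ η 0 ≤ |pqr h η 0| + pqr h η 1 + pqr h η 2 ∧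
      |pqr h η 0| + pqr h η 1 + pqr h η 2 ≤ 3 ∧ 0 ≤ jacEdge h η ∧ jacEdge h η ≤ η 0 ^ 2 := by
  obtain ⟨l, r⟩ := hη
  have a0 : 0 ≤ η 0 := l 0
  have a1 : 0 ≤ η 1 := l 1
  have a2 : 0 ≤ η 2 := l 2
  have b0 : η 0 ≤ 1 := r 0
  have b1 : η 1 ≤ 1 := r 1
  have b2 : η 2 ≤ 1 := r 2
  have c1 : 0 ≤ 1 - η 1 := by linarith
  have c2 : 0 ≤ 1 - η 2 := by linarith
  have d01 : 0 ≤ η 0 * η 1 := by positivity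
  have d012 : 0 ≤ η 0 * η 1 * η 2 := by positivity
  have d02 : 0 ≤ η 0 * η 2 := by positivity
  have e01 : 0 ≤ η 0 * (1 - η 1) := by positivity
  have e02 : 0 ≤ η 0 * (1 - η 2) := by positivity
  have e012 : 0 ≤ η 0 * η 1 * (1 - η 2) := by positivity
  have f : 0 ≤ η 0 ^ 2 * (1 - η 1) := by positivity
  have g : 0 ≤ η 0 ^ 2 * η 1 := by positivity
  fin_cases h <;>
    simp only [pqr, jacEdge, Fin.zero_eta, Fin.mk_one, Fin.reduceFinMk, Matrix.cons_val, abs_neg,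
      abs_of_nonneg d01, abs_of_nonneg d012] <;>
    refine ⟨?_, ?_, ?_, ?_, ?_, ?_⟩ <;> nlinarith

lemma shape_le (i : Fin 4) (w : Fin 3 → ℝ) (h1 : 0 ≤ w 1) (h2 : 0 ≤ w 2) :
    |shape i w| ≤ |w 0| + w 1 + w 2 := by
  have := abs_nonneg (w 0)
  have := le_abs_self (w 0)
  have := neg_abs_le (w 0)
  rw [abs_le]
  fin_cases i <;> simp only [shape, Fin.zero_eta, Fin.mk_one, Fin.reduceFinMk, Matrix.cons_val] <;>
    constructor <;> linarith

lemma cube_integrable (s : ℝ) (hs : s ∈ Set.Ioo (0:ℝ) 1) (u p q : EuclideanSpace ℝ (Fin 2))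
    (i j : Fin 4) (hc : cross u p * cross u q < 0) (h : Fin 5) :
    IntegrableOn (fun η => edgeKer s u p q i j (pqr h η) * jacEdge h η) (Set.Icc 0 1) := by
  obtain ⟨C, hC, hb⟩ := vec_bound u p q hc
  obtain ⟨hs0, hs1⟩ := hs
  refine Measure.integrableOn_of_bounded (M := 3 ^ (2 - 2 * s) * C ^ ((2 : ℝ) + 2 * s)) ?_ ?_ ?_
  · exact (isCompact_Icc.measure_lt_top).ne
  · exact (((ker_measurable s u p q i j).comp (pqr_measurable h)).mul
      (jac_measurable h)).aestronglyMeasurable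
  · rw [ae_restrict_iff' measurableSet_Icc]
    refine Filter.Eventually.of_forall fun η hη => ?_
    obtain ⟨h1, h2, h3, h4, h5, h6⟩ := pqr_facts h η hη
    have hbw := hb (pqr h η) h1 h2
    have si := shape_le i _ h1 h2
    have sj := shape_le j _ h1 h2
    have hη0 : 0 ≤ η 0 := hη.1 0
    set w := pqr h η with hw
    set N := |w 0| + w 1 + w 2 with hN
    have hN0 : 0 ≤ N := by linarith
    set V := ‖vec u p q w‖ with hV
    have hV0 : 0 ≤ V := norm_nonneg _
    have hJ : jacEdge h η ≤ N ^ 2 := h6.trans (by gcongr)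
    rw [Real.norm_eq_abs, abs_mul, abs_of_nonneg h5, edgeKer, ← hV, abs_div, abs_mul,
      abs_of_nonneg (Real.rpow_nonneg hV0 _)]
    have hbound : 0 ≤ (3:ℝ) ^ (2 - 2 * s) * C ^ ((2 : ℝ) + 2 * s) := by positivity
    have hN4 : N * N * N ^ 2 = N ^ (2 - 2 * s) * N ^ ((2 : ℝ) + 2 * s) := by
      rw [← Real.rpow_add_of_nonneg hN0 (by linarith) (by linarith)]
      have : 2 - 2 * s + (2 + 2 * s) = (4 : ℕ) := by push_cast; ring
      rw [this, Real.rpow_natCast]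
      ring
    rw [div_mul_eq_mul_div]
    apply div_le_of_le_mul₀ (Real.rpow_nonneg hV0 _) hbound
    calc |shape i w| * |shape j w| * jacEdge h η ≤ N * N * N ^ 2 := by gcongr
      _ = N ^ (2 - 2 * s) * N ^ ((2 : ℝ) + 2 * s) := hN4
      _ ≤ 3 ^ (2 - 2 * s) * (C * V) ^ ((2 : ℝ) + 2 * s) := by
        gcongr
        linarith
      _ = 3 ^ (2 - 2 * s) * C ^ ((2 : ℝ) + 2 * s) * V ^ ((2 : ℝ) + 2 * s) := by
        rw [Real.mul_rpow hC.le hV0]; ring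

/-- **Reduction of the singular integral over a pair of edge-touching triangles.**
If the triangles `T_ℓ = conv(a,b,c_ℓ)` and `T_m = conv(a,b,c_m)` intersect exactly in the
common edge `[a,b]`, then for all local indices `i, j` the singular double integral over
`T̂ × T̂` is absolutely convergent and equals `1/(4−2s)` times the sum of five regular
integrals over the unit cube `[0,1]³`. -/
theorem edge_touching_reduction (s : ℝ) (hs : s ∈ Set.Ioo (0:ℝ) 1)
    (a b cl cm : EuclideanSpace ℝ (Fin 2))
    (hTl : ¬ Collinear ℝ ({a, b, cl} : Set (EuclideanSpace ℝ (Fin 2))))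
    (hTm : ¬ Collinear ℝ ({a, b, cm} : Set (EuclideanSpace ℝ (Fin 2))))
    (hint : convexHull ℝ ({a, b, cl} : Set (EuclideanSpace ℝ (Fin 2))) ∩
        convexHull ℝ ({a, b, cm} : Set (EuclideanSpace ℝ (Fin 2))) = segment ℝ a b)
    (i j : Fin 4) :
    IntegrableOn
      (fun q : EuclideanSpace ℝ (Fin 2) × EuclideanSpace ℝ (Fin 2) =>
        phiEdge i q.1 q.2 * phiEdge j q.1 q.2 /
          ‖(Matrix.toEuclideanLin (colMatrix (b - a) (cl - b)) q.1 + a) -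
              (Matrix.toEuclideanLin (colMatrix (b - a) (cm - b)) q.2 + a)‖ ^
            ((2 : ℝ) + 2 * s))
      (refTriangle ×ˢ refTriangle) volume ∧
    (∀ h : Fin 5, IntegrableOn
      (fun η : Fin 3 → ℝ => psiEdge h i η * psiEdge h j η * jacEdge h η /
        ‖dEdge (colMatrix (b - a) (cl - b)) (colMatrix (b - a) (cm - b)) h η‖ ^
          ((2 : ℝ) + 2 * s))
      (Set.Icc 0 1) volume) ∧
    ∫ x in refTriangle, ∫ y in refTriangle,
        phiEdge i x y * phiEdge j x y /
          ‖(Matrix.toEuclideanLin (colMatrix (b - a) (cl - b)) x + a) -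
              (Matrix.toEuclideanLin (colMatrix (b - a) (cm - b)) y + a)‖ ^
            ((2 : ℝ) + 2 * s) =
      (1 / (4 - 2 * s)) *
        ∑ h : Fin 5, ∫ η in Set.Icc (0 : Fin 3 → ℝ) 1,
          psiEdge h i η * psiEdge h j η * jacEdge h η /
            ‖dEdge (colMatrix (b - a) (cl - b)) (colMatrix (b - a) (cm - b)) h η‖ ^
              ((2 : ℝ) + 2 * s) := by
  have hc := cross_opposite a b cl cm (cross_ne_zero a b cl hTl) (cross_ne_zero a b cm hTm) hint
  have hR := fun h => cube_integrable s hs (b - a) (cl - b) (cm - b) i j hc h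
  obtain ⟨hI, hE⟩ := TT_integral s hs.2 (edgeKer s (b - a) (cl - b) (cm - b) i j)
    (fun ξ hξ w => ker_hom s _ _ _ i j ξ hξ w) hR
  have hF : ∀ q : EuclideanSpace ℝ (Fin 2) × EuclideanSpace ℝ (Fin 2),
      phiEdge i q.1 q.2 * phiEdge j q.1 q.2 /
          ‖(Matrix.toEuclideanLin (colMatrix (b - a) (cl - b)) q.1 + a) -
              (Matrix.toEuclideanLin (colMatrix (b - a) (cm - b)) q.2 + a)‖ ^
            ((2 : ℝ) + 2 * s) =
        edgeKer s (b - a) (cl - b) (cm - b) i j (dif (coordEquiv q)) := by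
    intro q
    rw [edgeKer, phi_eq, phi_eq, edge_diff_eq]
  have hG : ∀ (h : Fin 5) (η : Fin 3 → ℝ), psiEdge h i η * psiEdge h j η * jacEdge h η /
        ‖dEdge (colMatrix (b - a) (cl - b)) (colMatrix (b - a) (cm - b)) h η‖ ^
          ((2 : ℝ) + 2 * s) =
        edgeKer s (b - a) (cl - b) (cm - b) i j (pqr h η) * jacEdge h η := by
    intro h η
    rw [edgeKer, psi_eq, psi_eq, dEdge_eq]
    ring
  have hInt : IntegrableOn (fun q => edgeKer s (b - a) (cl - b) (cm - b) i j (dif (coordEquiv q)))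
      (refTriangle ×ˢ refTriangle) volume := by
    have := (coordEquiv_mp.integrableOn_comp_preimage coordEquiv.measurableEmbedding).2 hI
    rw [coordEquiv_preimage] at this
    exact this
  refine ⟨?_, ?_, ?_⟩
  · simp_rw [hF]
    exact hInt
  · intro h
    simp_rw [hG]
    exact hR h
  · simp_rw [hG]
    rw [← hE, ← coordEquiv_mp.setIntegral_preimage_emb coordEquiv.measurableEmbedding,
      coordEquiv_preimage, Measure.volume_eq_prod, setIntegral_prod]
    · simp_rw [← hF]
    · rw [← Measure.volume_eq_prod]
      exact hInt
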